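/- arXiv:2502.16299 — 2 statements merged into one kernel-verified Lean document; each statement's English description precedes it below -/
import Mathlib

section
/- Conditioning on any measurable function yields a calibrated predictor (Proposition 1 of Vaicenavicius et al., used in Appendix B): Let (Ω, 𝒜, P) be a probability space, 𝒳 and 𝒵 measurable spaces, X : Ω → 𝒳 measurable, Y : Ω → Fin K measurable, h : 𝒳 → 𝒵 measurable, and g : 𝒵 → (Fin K → ℝ) bounded measurable; set f = g ∘ h. If for every k ∈ Fin K the function ω ↦ f(X(ω))_k is a version of E[1_{Y=k} ∣ σ(h∘X)], then f∘X is calibrated in distribution: for every k ∈ Fin K, E[1_{Y=k} ∣ σ(f∘X)] = (f∘X)_k P-almost surely. -/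
open MeasureTheory

/-- A version of a conditional expectation that is measurable with respect to a smaller σ-algebra
is also a version of the conditional expectation given that smaller σ-algebra. -/
theorem condExp_ae_eq_of_condExp_ae_eq_of_le {Ω E : Type*} [NormedAddCommGroup E]
    [NormedSpace ℝ E] [CompleteSpace E] {m₁ m₂ m₀ : MeasurableSpace Ω} {μ : Measure Ω}
    [IsFiniteMeasure μ] {u v : Ω → E} (hm₁₂ : m₁ ≤ m₂) (hm₂ : m₂ ≤ m₀)
    (hv : StronglyMeasurable[m₁] v) (huv : μ[u | m₂] =ᵐ[μ] v) :
    μ[u | m₁] =ᵐ[μ] v :=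
  calc μ[u | m₁] =ᵐ[μ] μ[μ[u | m₂] | m₁] := (condExp_condExp_of_le hm₁₂ hm₂).symm
    _ =ᵐ[μ] μ[v | m₁] := condExp_congr_ae huv
    _ = v := condExp_of_stronglyMeasurable (hm₁₂.trans hm₂) hv (integrable_condExp.congr huv)

/-- **Conditioning on any measurable function yields a calibrated predictor**
(Proposition 1 of Vaicenavicius et al.).  With `f = g ∘ h`, if for every class
`k` the map `ω ↦ f (X ω) k` is a version of `E[1_{Y=k} ∣ σ(h ∘ X)]`, then
`f ∘ X` is calibrated in distribution. -/
theorem conditioning_yields_calibrated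
    {Ω 𝓧 𝓩 : Type*} [MeasurableSpace Ω] [MeasurableSpace 𝓧] [MeasurableSpace 𝓩]
    (μ : Measure Ω) [IsProbabilityMeasure μ]
    {K : ℕ} (hK : 1 ≤ K)
    (X : Ω → 𝓧) (hX : Measurable X)
    (Y : Ω → Fin K) (hY : Measurable Y)
    (h : 𝓧 → 𝓩) (hh : Measurable h)
    (g : 𝓩 → Fin K → ℝ) (hg : Measurable g)
    (hbdd : ∃ C : ℝ, ∀ z k, |g z k| ≤ C)
    (f : 𝓧 → Fin K → ℝ) (hfdef : f = g ∘ h)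
    (hcond : ∀ k : Fin K,
      μ[Set.indicator {ω | Y ω = k} (fun _ => (1 : ℝ)) |
          MeasurableSpace.comap (fun ω => h (X ω)) inferInstance]
        =ᵐ[μ] fun ω => f (X ω) k) :
    ∀ k : Fin K,
      μ[Set.indicator {ω | Y ω = k} (fun _ => (1 : ℝ)) |
          MeasurableSpace.comap (fun ω => f (X ω)) inferInstance]
        =ᵐ[μ] fun ω => f (X ω) k := by
  intro k
  refine condExp_ae_eq_of_condExp_ae_eq_of_le ?_ (hh.comp hX).comap_le ?_ (hcond k)
  · refine measurable_iff_comap_le.mp ?_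
    rw [hfdef]
    exact hg.comp (comap_measurable _)
  · exact ((measurable_pi_apply k).comp
      (comap_measurable fun ω => f (X ω))).stronglyMeasurable
end

section
/- The kernel calibration error of a calibrated predictor vanishes (the 'only if' direction of the identity CE_k(f) = 0 ⇔ f calibrated, asserted for the calibration errors used in the test): Let (Ω, 𝒜, P) be a probability space, Y, Y' : Ω → Fin K measurable, and g, g' : Ω → (Fin K → ℝ) measurable maps taking values in the probability simplex. Assume the pairs (g, Y) and (g', Y') are independent, and that both g and g' are calibrated in distribution (with respect to Y and Y' respectively). Then for every bounded measurable matrix-valued kernel k : (Fin K → ℝ) × (Fin K → ℝ) → Matrix (Fin K) (Fin K) ℝ, E[(e_Y − g)ᵀ · k(g, g') · (e_{Y'} − g')] = 0, where (e_Y − g)ᵀ · k(g, g') · (e_{Y'} − g') = Σ_{a,b} (1_{Y=a} − g_a) · k(g, g')_{a,b} · (1_{Y'=b} − g'_b). -/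
open MeasureTheory ProbabilityTheory

/-- Testing a conditional expectation against a bounded measurable function of the conditioning
variable: if `E[f ∣ σ(g)] = φ` almost surely, then `E[(f - φ) · h(g)] = 0`. -/
lemma integral_sub_mul_comp_eq_zero_of_condExp_comap
    {Ω E : Type*} [MeasurableSpace Ω] [MeasurableSpace E]
    {μ : Measure Ω} [IsProbabilityMeasure μ]
    {g : Ω → E} (hg : Measurable g) {f φ : Ω → ℝ}
    (hf : Integrable f μ) (hφ : Integrable φ μ)
    (hcond : μ[f | MeasurableSpace.comap g inferInstance] =ᵐ[μ] φ)
    {h : E → ℝ} (hh : Measurable h) {C : ℝ} (hC : ∀ x, |h x| ≤ C) :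
    ∫ ω, (f ω - φ ω) * h (g ω) ∂μ = 0 := by
  have hm : MeasurableSpace.comap g inferInstance ≤ (inferInstance : MeasurableSpace Ω) :=
    hg.comap_le
  have hhg : StronglyMeasurable[MeasurableSpace.comap g inferInstance] (fun ω => h (g ω)) :=
    (hh.comp (comap_measurable g)).stronglyMeasurable
  have hbdd : ∀ᵐ ω ∂μ, ‖h (g ω)‖ ≤ C := Filter.Eventually.of_forall fun ω => hC (g ω)
  have hae : AEStronglyMeasurable (fun ω => h (g ω)) μ := (hh.comp hg).aestronglyMeasurable
  have hfh : Integrable (fun ω => f ω * h (g ω)) μ := hf.mul_bdd hae hbdd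
  have hφh : Integrable (fun ω => φ ω * h (g ω)) μ := hφ.mul_bdd hae hbdd
  have hpull : μ[fun ω => f ω * h (g ω) | MeasurableSpace.comap g inferInstance]
      =ᵐ[μ] fun ω => φ ω * h (g ω) := by
    refine (condExp_mul_of_stronglyMeasurable_right hhg hfh hf).trans ?_
    filter_upwards [hcond] with ω hω
    simp [hω]
  simp only [sub_mul]
  rw [integral_sub hfh hφh, ← integral_condExp hm, integral_congr_ae hpull, sub_self]

/-- **The kernel calibration error of a calibrated predictor vanishes.**
If the pairs `(g, Y)` and `(g', Y')` are independent and both simplex-valued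
predictors `g` and `g'` are calibrated in distribution (w.r.t. `Y` and `Y'`
respectively), then for every bounded measurable matrix-valued kernel `k`,
`E[(e_Y − g)ᵀ · k(g, g') · (e_{Y'} − g')] = 0`. -/
theorem kernel_calibration_error_of_calibrated_vanishes
    {Ω : Type*} [MeasurableSpace Ω]
    (μ : Measure Ω) [IsProbabilityMeasure μ]
    {K : ℕ} (hK : 1 ≤ K)
    (Y Y' : Ω → Fin K) (hY : Measurable Y) (hY' : Measurable Y')
    (g g' : Ω → Fin K → ℝ) (hg : Measurable g) (hg' : Measurable g')
    (hgsimplex : ∀ ω, (∀ j, 0 ≤ g ω j) ∧ ∑ j, g ω j = 1)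
    (hg'simplex : ∀ ω, (∀ j, 0 ≤ g' ω j) ∧ ∑ j, g' ω j = 1)
    (hindep : IndepFun (fun ω => (g ω, Y ω)) (fun ω => (g' ω, Y' ω)) μ)
    (hcal : ∀ j : Fin K,
      μ[Set.indicator {ω | Y ω = j} (fun _ => (1 : ℝ)) |
          MeasurableSpace.comap g inferInstance]
        =ᵐ[μ] fun ω => g ω j)
    (hcal' : ∀ j : Fin K,
      μ[Set.indicator {ω | Y' ω = j} (fun _ => (1 : ℝ)) |
          MeasurableSpace.comap g' inferInstance]
        =ᵐ[μ] fun ω => g' ω j)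
    (k : (Fin K → ℝ) × (Fin K → ℝ) → Matrix (Fin K) (Fin K) ℝ)
    (hkmeas : ∀ a b : Fin K, Measurable fun x => k x a b)
    (hkbdd : ∃ C : ℝ, ∀ x a b, |k x a b| ≤ C) :
    ∫ ω, ∑ a : Fin K, ∑ b : Fin K,
        (Set.indicator {ω' | Y ω' = a} (fun _ => (1 : ℝ)) ω - g ω a)
          * k (g ω, g' ω) a b
          * (Set.indicator {ω' | Y' ω' = b} (fun _ => (1 : ℝ)) ω - g' ω b) ∂μ
      = 0 := by
  obtain ⟨C, hC⟩ := hkbdd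
  have bound : ∀ {Z : Ω → Fin K} {p : Ω → Fin K → ℝ},
      (∀ ω, (∀ j, 0 ≤ p ω j) ∧ ∑ j, p ω j = 1) → ∀ a ω,
      ‖Set.indicator {ω' | Z ω' = a} (fun _ => (1 : ℝ)) ω - p ω a‖ ≤ 1 := by
    intro Z p hp a ω
    have h0 := (hp ω).1 a
    have h1 : p ω a ≤ 1 := (hp ω).2 ▸
      Finset.single_le_sum (fun j _ => (hp ω).1 j) (Finset.mem_univ a)
    rw [Real.norm_eq_abs, abs_le]
    by_cases hZ : Z ω = a <;> simp [Set.indicator, hZ] <;> constructor <;> linarith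
  have hind : ∀ {Z : Ω → Fin K}, Measurable Z → ∀ a,
      Measurable (Set.indicator {ω | Z ω = a} (fun _ => (1 : ℝ))) := fun hZ a =>
    measurable_const.indicator (hZ (measurableSet_singleton a))
  have hga : ∀ a, Measurable fun ω => g ω a := fun a => (measurable_pi_apply a).comp hg
  have hga' : ∀ a, Measurable fun ω => g' ω a := fun a => (measurable_pi_apply a).comp hg'
  have hint : ∀ a b, Integrable (fun ω =>
      (Set.indicator {ω' | Y ω' = a} (fun _ => (1 : ℝ)) ω - g ω a)
        * k (g ω, g' ω) a b
        * (Set.indicator {ω' | Y' ω' = b} (fun _ => (1 : ℝ)) ω - g' ω b)) μ := by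
    intro a b
    refine Integrable.of_bound ((((hind hY a).sub (hga a)).mul
      ((hkmeas a b).comp (hg.prodMk hg'))).mul
        ((hind hY' b).sub (hga' b))).aestronglyMeasurable (1 * C * 1)
      (Filter.Eventually.of_forall fun ω => ?_)
    rw [norm_mul, norm_mul]
    have hC0 : 0 ≤ C := (abs_nonneg _).trans (hC (g ω, g' ω) a b)
    exact mul_le_mul (mul_le_mul (bound hgsimplex a ω) (hC _ a b) (norm_nonneg _) zero_le_one)
      (bound hg'simplex b ω) (norm_nonneg _) (by positivity)
  rw [integral_finsetSum _ fun a _ => integrable_finsetSum _ fun b _ => hint a b]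
  refine Finset.sum_eq_zero fun a _ => ?_
  rw [integral_finsetSum _ fun b _ => hint a b]
  refine Finset.sum_eq_zero fun b _ => ?_
  have hgY : Measurable fun ω => (g ω, Y ω) := hg.prodMk hY
  have hgY' : Measurable fun ω => (g' ω, Y' ω) := hg'.prodMk hY'
  let resid : Fin K → (Fin K → ℝ) × Fin K → ℝ := fun c z =>
    Set.indicator {z' : (Fin K → ℝ) × Fin K | z'.2 = c} (fun _ => (1 : ℝ)) z - z.1 c
  have hresid : ∀ c, Measurable (resid c) := fun c =>
    (measurable_const.indicator (measurable_snd (measurableSet_singleton c))).sub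
      ((measurable_pi_apply c).comp measurable_fst)
  let F : ((Fin K → ℝ) × Fin K) × ((Fin K → ℝ) × Fin K) → ℝ := fun z =>
    resid a z.1 * k (z.1.1, z.2.1) a b * resid b z.2
  have hF : Measurable F :=
    (((hresid a).comp measurable_fst).mul ((hkmeas a b).comp
      ((measurable_fst.comp measurable_fst).prodMk (measurable_fst.comp measurable_snd)))).mul
      ((hresid b).comp measurable_snd)
  have hlaw := (indepFun_iff_map_prod_eq_prod_map_map hgY.aemeasurable hgY'.aemeasurable).1 hindep
  have hFint : Integrable F
      ((μ.map fun ω => (g ω, Y ω)).prod (μ.map fun ω => (g' ω, Y' ω))) := by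
    rw [← hlaw, integrable_map_measure hF.aestronglyMeasurable (hgY.prodMk hgY').aemeasurable]
    exact hint a b
  have hmap := integral_map (μ := μ) (hgY.prodMk hgY').aemeasurable (f := F)
    hF.aestronglyMeasurable
  have : IsProbabilityMeasure (μ.map fun ω => (g ω, Y ω)) :=
    Measure.isProbabilityMeasure_map hgY.aemeasurable
  have : IsProbabilityMeasure (μ.map fun ω => (g' ω, Y' ω)) :=
    Measure.isProbabilityMeasure_map hgY'.aemeasurable
  refine hmap.symm.trans ?_
  rw [hlaw, integral_prod_symm _ hFint]
  refine integral_eq_zero_of_ae (Filter.Eventually.of_forall fun z' => ?_)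
  simp only [F, Pi.zero_apply]
  have hk : Measurable fun x => k (x, z'.1) a b :=
    (hkmeas a b).comp (measurable_id.prodMk measurable_const)
  rw [integral_mul_const]
  refine mul_eq_zero_of_left ((integral_map hgY.aemeasurable
    ((hresid a).mul (hk.comp measurable_fst)).aestronglyMeasurable).trans ?_) _
  have hfint : Integrable (Set.indicator {ω | Y ω = a} (fun _ => (1 : ℝ))) μ :=
    (integrable_const 1).indicator (hY (measurableSet_singleton a))
  have hφint : Integrable (fun ω => g ω a) μ := integrable_condExp.congr (hcal a)
  exact integral_sub_mul_comp_eq_zero_of_condExp_comap hg hfint hφint (hcal a) hk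
    fun x => hC (x, z'.1) a b
end
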